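/- arXiv:2311.01074 — 3 statements merged into one kernel-verified Lean document; each statement's English description precedes it below -/
import Mathlib

section
/- (Proposition 2) Let a > 0, b > 0, L > 0, U ∈ (0, L), and v₀ < 0 with v₀² - a/U < 0. Set C = v₀² - a/U + b/(L-U) and β = a/U - v₀². Let u : [0, T_u] → ℝ be continuous, differentiable on [0, T_u), with u(0) = U, u(T_u) = 0, 0 < u(t) < L and u'(t) = -√(a/u(t) - b/(L-u(t)) + C) on [0, T_u); let w : [0, T_w] → ℝ be continuous, differentiable on [0, T_w), with w(0) = U, w(T_w) = 0, w(t) > 0 and w'(t) = -√(a/w(t) - β) on [0, T_w). Then u(t) ≤ w(t) for all t in the common domain of existence, and T_u ≤ T_w, i.e. the collapse time with the repeller is less than the value given by Proposition 1 with W = U, K = a, β = a/U - v₀². -/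
/-- A function on `[0, T]` whose derivative on `[0, T)` is the negative of a square root is antitone. -/
theorem antitoneOn_Icc_of_hasDerivWithinAt_neg_sqrt {T : ℝ} {f g : ℝ → ℝ}
    (hf : ContinuousOn f (Set.Icc 0 T))
    (hd : ∀ t ∈ Set.Ico (0 : ℝ) T, HasDerivWithinAt f (-Real.sqrt (g t)) (Set.Icc 0 T) t) :
    AntitoneOn f (Set.Icc 0 T) := by
  refine antitoneOn_of_hasDerivWithinAt_nonpos (f' := fun t => -Real.sqrt (g t))
    (convex_Icc 0 T) hf ?_ ?_
  · intro t ht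
    rw [interior_Icc] at ht
    exact (hd t ⟨ht.1.le, ht.2⟩).mono interior_subset
  · intro t _
    exact neg_nonpos.2 (Real.sqrt_nonneg (g t))

/-- One-sided Lipschitz bound for `x ↦ -√(a / x - β)`, also when the radicand at `y` is replaced
by a larger `X`, for `x` and `X` bounded away from zero. -/
theorem sqrt_div_sub_sub_sqrt_le {a β m c x y X : ℝ} (ha : 0 < a) (hm : 0 < m) (hc : 0 < c)
    (hmx : m ≤ x) (hxy : x ≤ y) (hX : c ^ 2 ≤ X) (hyX : a / y - β ≤ X) :
    Real.sqrt (a / x - β) - Real.sqrt X ≤ a / (m ^ 2 * c) * (y - x) := by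
  have hx : 0 < x := hm.trans_le hmx
  have hy : 0 < y := hx.trans_le hxy
  have hcX : c ≤ Real.sqrt X := Real.le_sqrt_of_sq_le hX
  have hK : 0 ≤ a / (m ^ 2 * c) * (y - x) :=
    mul_nonneg (by positivity) (sub_nonneg.2 hxy)
  have hdiff : a / x - a / y ≤ c * (a / (m ^ 2 * c) * (y - x)) := by
    have h1 : a / x - a / y = a * (y - x) / (x * y) := by field_simp
    have h2 : c * (a / (m ^ 2 * c) * (y - x)) = a * (y - x) / m ^ 2 := by field_simp
    rw [h1, h2]
    have : 0 ≤ y - x := sub_nonneg.2 hxy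
    have : m ^ 2 ≤ x * y := by nlinarith
    gcongr
  rw [sub_le_iff_le_add]
  refine Real.sqrt_le_iff.2 ⟨by positivity, ?_⟩
  have hsq : Real.sqrt X ^ 2 = X := Real.sq_sqrt ((sq_nonneg c).trans hX)
  nlinarith [mul_le_mul_of_nonneg_right hcX hK, sq_nonneg (a / (m ^ 2 * c) * (y - x))]

/-- If `u 0 ≤ w 0` and `u' ≤ w' + K (u - w)` wherever `w < u`, then `u ≤ w`. -/
theorem le_of_hasDerivWithinAt_le_add_mul {T K : ℝ} {u w u' w' : ℝ → ℝ} (hT : 0 ≤ T)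
    (hu : ContinuousOn u (Set.Icc 0 T)) (hw : ContinuousOn w (Set.Icc 0 T))
    (hu' : ∀ t ∈ Set.Ico 0 T, HasDerivWithinAt u (u' t) (Set.Ici t) t)
    (hw' : ∀ t ∈ Set.Ico 0 T, HasDerivWithinAt w (w' t) (Set.Ici t) t)
    (h0 : u 0 ≤ w 0)
    (hK : ∀ t ∈ Set.Ico 0 T, w t < u t → u' t ≤ w' t + K * (u t - w t)) :
    u T ≤ w T := by
  have key : ∀ ε > 0, u T - w T ≤ ε * Real.exp ((K + 1) * T) := by
    intro ε hε
    have hB : ∀ t, HasDerivAt (fun t => ε * Real.exp ((K + 1) * t))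
        (ε * (Real.exp ((K + 1) * t) * ((K + 1) * 1))) t := fun t =>
      (((hasDerivAt_id t).const_mul (K + 1)).exp).const_mul ε
    refine image_le_of_deriv_right_lt_deriv_boundary (f := fun t => u t - w t)
      (f' := fun t => u' t - w' t) (hu.sub hw)
      (fun t ht => (hu' t ht).sub (hw' t ht)) ?_ hB ?_ (Set.right_mem_Icc.2 hT)
    · simp only [mul_zero, Real.exp_zero, mul_one]
      linarith
    · intro t ht heq
      have hpos : 0 < ε * Real.exp ((K + 1) * t) := by positivity
      have := hK t ht (by linarith)
      rw [heq] at this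
      linarith
  by_contra! hlt
  have hE : 0 < Real.exp ((K + 1) * T) := Real.exp_pos _
  have := key ((u T - w T) / (2 * Real.exp ((K + 1) * T)))
    (div_pos (sub_pos.2 hlt) (by positivity))
  have h2 : (u T - w T) / (2 * Real.exp ((K + 1) * T)) * Real.exp ((K + 1) * T)
      = (u T - w T) / 2 := by field_simp
  linarith


/-- (Proposition 2) Comparison of the dipole trajectory `u` with the
attractor-only trajectory `w` (same initial position `U`, `β = a/U - v₀²`):
`u ≤ w` on the common domain of existence and the collapse time with the
repeller is less than the collapse time without it. -/
theorem dipole_collapse_earlier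
    (a b L U v₀ Tu Tw : ℝ) (ha : 0 < a) (hb : 0 < b) (hL : 0 < L)
    (hU : U ∈ Set.Ioo (0 : ℝ) L) (hv₀ : v₀ < 0)
    (hneg : v₀ ^ 2 - a / U < 0)
    (hTu : 0 < Tu) (hTw : 0 < Tw)
    (u w : ℝ → ℝ)
    (hucont : ContinuousOn u (Set.Icc 0 Tu))
    (hu0 : u 0 = U) (huT : u Tu = 0)
    (hurange : ∀ t ∈ Set.Ico (0 : ℝ) Tu, 0 < u t ∧ u t < L)
    (huderiv : ∀ t ∈ Set.Ico (0 : ℝ) Tu,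
      HasDerivWithinAt u
        (-Real.sqrt (a / u t - b / (L - u t) + (v₀ ^ 2 - a / U + b / (L - U))))
        (Set.Icc (0 : ℝ) Tu) t)
    (hwcont : ContinuousOn w (Set.Icc 0 Tw))
    (hw0 : w 0 = U) (hwT : w Tw = 0)
    (hwpos : ∀ t ∈ Set.Ico (0 : ℝ) Tw, 0 < w t)
    (hwderiv : ∀ t ∈ Set.Ico (0 : ℝ) Tw,
      HasDerivWithinAt w (-Real.sqrt (a / w t - (a / U - v₀ ^ 2)))
        (Set.Icc (0 : ℝ) Tw) t) :
    (∀ t ∈ Set.Icc (0 : ℝ) (min Tu Tw), u t ≤ w t) ∧ Tu ≤ Tw := by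
  have hUpos := hU.1
  have hUL := hU.2
  have huanti := antitoneOn_Icc_of_hasDerivWithinAt_neg_sqrt hucont huderiv
  have hwanti := antitoneOn_Icc_of_hasDerivWithinAt_neg_sqrt hwcont hwderiv
  have hright : ∀ {f : ℝ → ℝ} {f' S t : ℝ}, t ∈ Set.Ico 0 S →
      HasDerivWithinAt f f' (Set.Icc 0 S) t → HasDerivWithinAt f f' (Set.Ici t) t := by
    intro f f' S t ht h
    exact h.mono_of_mem_nhdsWithin (Filter.mem_of_superset (Icc_mem_nhdsGE ht.2)
      (Set.Icc_subset_Icc_left ht.1))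
  have hlt : ∀ T ∈ Set.Ico (0 : ℝ) (min Tu Tw), u T ≤ w T := by
    intro T hT
    have hTTu : T < Tu := hT.2.trans_le (min_le_left _ _)
    have hTTw : T < Tw := hT.2.trans_le (min_le_right _ _)
    refine le_of_hasDerivWithinAt_le_add_mul (K := a / (w T ^ 2 * -v₀)) hT.1
      (hucont.mono (Set.Icc_subset_Icc_right hTTu.le))
      (hwcont.mono (Set.Icc_subset_Icc_right hTTw.le))
      (fun t ht => hright ⟨ht.1, ht.2.trans hTTu⟩ (huderiv t ⟨ht.1, ht.2.trans hTTu⟩))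
      (fun t ht => hright ⟨ht.1, ht.2.trans hTTw⟩ (hwderiv t ⟨ht.1, ht.2.trans hTTw⟩))
      (by rw [hu0, hw0]) ?_
    intro t ht hwu
    have htu : t < Tu := ht.2.trans hTTu
    have htw : t < Tw := ht.2.trans hTTw
    have hutpos := (hurange t ⟨ht.1, htu⟩).1
    have hutU : u t ≤ U := hu0 ▸ huanti ⟨le_rfl, hTu.le⟩ ⟨ht.1, htu.le⟩ ht.1
    have hwTt : w T ≤ w t := hwanti ⟨ht.1, htw.le⟩ ⟨hT.1, hTTw.le⟩ ht.2.le
    have hrep : b / (L - u t) ≤ b / (L - U) :=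
      div_le_div_of_nonneg_left hb.le (by linarith) (by linarith)
    have hatt : a / U ≤ a / u t := div_le_div_of_nonneg_left ha.le hutpos hutU
    have := sqrt_div_sub_sub_sqrt_le (β := a / U - v₀ ^ 2)
      (X := a / u t - b / (L - u t) + (v₀ ^ 2 - a / U + b / (L - U)))
      ha (hwpos T ⟨hT.1, hTTw⟩) (neg_pos.2 hv₀) hwTt hwu.le
      (by rw [neg_sq]; linarith) (by linarith)
    linarith
  have hle : ∀ t ∈ Set.Icc (0 : ℝ) (min Tu Tw), u t ≤ w t := by
    intro t ht
    have hcl : t ∈ closure (Set.Ico (0 : ℝ) (min Tu Tw)) := by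
      rwa [closure_Ico (lt_min hTu hTw).ne]
    have hsub : Set.Ico (0 : ℝ) (min Tu Tw) ⊆ Set.Icc 0 (min Tu Tw) := Set.Ico_subset_Icc_self
    refine ContinuousWithinAt.closure_le hcl ?_ ?_ hlt
    · exact (hucont t ⟨ht.1, ht.2.trans (min_le_left _ _)⟩).mono
        (hsub.trans (Set.Icc_subset_Icc_right (min_le_left _ _)))
    · exact (hwcont t ⟨ht.1, ht.2.trans (min_le_right _ _)⟩).mono
        (hsub.trans (Set.Icc_subset_Icc_right (min_le_right _ _)))
  refine ⟨hle, ?_⟩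
  by_contra! h
  have h1 := hle Tw ⟨hTw.le, le_min h.le le_rfl⟩
  have h2 := (hurange Tw ⟨hTw.le, h⟩).1
  linarith
end

section
/- Let a > 0, b > 0, L > 0, U ∈ (0, L), v₀ ∈ ℝ with v₀² - a/U < 0, and set C = v₀² - a/U + b/(L-U), β = a/U - v₀² > 0. Then ∫₀^U √(u(L-u)) / √(C u (L-u) - (a+b) u + a L) du < ∫₀^U √u / √(a - β u) du. -/
/-- The integrand `√u / √(a - (a / U - v²) u)` has at worst an inverse square root singularity at
`U`, so it is interval integrable on `[0, U]`. -/
lemma intervalIntegrable_sqrt_div_sqrt_sub {a U : ℝ} (v : ℝ) (ha : 0 < a) (hU : 0 < U) :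
    IntervalIntegrable (fun u => Real.sqrt u / Real.sqrt (a - (a / U - v ^ 2) * u))
      MeasureTheory.volume 0 U := by
  have hdom : IntervalIntegrable
      (fun u : ℝ => Real.sqrt U / Real.sqrt (a / U) * (U - u) ^ (-(1 / 2) : ℝ))
      MeasureTheory.volume 0 U := by
    have h := (intervalIntegral.intervalIntegrable_rpow' (a := 0) (b := U)
      (r := -(1 / 2)) (by norm_num)).comp_sub_left U
    simp only [sub_zero, sub_self] at h
    exact h.symm.const_mul _
  refine hdom.mono_fun' (Measurable.aestronglyMeasurable (by fun_prop)) ?_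
  rw [Set.uIoc_of_le hU.le, Filter.EventuallyLE,
    MeasureTheory.ae_restrict_iff' measurableSet_Ioc]
  filter_upwards [MeasureTheory.Measure.ae_ne MeasureTheory.volume U] with u hne hu
  have hlt : 0 < U - u := sub_pos.2 (lt_of_le_of_ne hu.2 hne)
  have hle : a / U * (U - u) ≤ a - (a / U - v ^ 2) * u := by
    have h : a - (a / U - v ^ 2) * u = a / U * (U - u) + v ^ 2 * u := by field_simp; ring
    rw [h]
    exact le_add_of_nonneg_right (mul_nonneg (sq_nonneg v) hu.1.le)
  rw [Real.norm_of_nonneg (by positivity), Real.rpow_neg hlt.le, ← Real.sqrt_eq_rpow,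
    ← div_eq_mul_inv, div_div, ← Real.sqrt_mul (by positivity)]
  have : 0 < a / U * (U - u) := by positivity
  gcongr
  exact hu.2

/-- Pointwise comparison of the two integrands: the repeller speeds up the motion. -/
lemma sqrt_div_sqrt_dipole_lt {a b L U u : ℝ} (v : ℝ) (ha : 0 < a) (hb : 0 < b)
    (hUL : U < L) (hu : u ∈ Set.Ioo 0 U) :
    Real.sqrt (u * (L - u)) /
        Real.sqrt ((v ^ 2 - a / U + b / (L - U)) * u * (L - u) - (a + b) * u + a * L) <
      Real.sqrt u / Real.sqrt (a - (a / U - v ^ 2) * u) := by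
  obtain ⟨hu0, huU⟩ := hu
  have hU : 0 < U := hu0.trans huU
  have hUu : 0 < U - u := sub_pos.2 huU
  have hLU : 0 < L - U := sub_pos.2 hUL
  have hLu : 0 < L - u := by linarith
  have hD : 0 < a - (a / U - v ^ 2) * u := by
    have h : a - (a / U - v ^ 2) * u = a / U * (U - u) + v ^ 2 * u := by field_simp; ring
    rw [h]
    positivity
  have hE : (v ^ 2 - a / U + b / (L - U)) * u * (L - u) - (a + b) * u + a * L =
      (a - (a / U - v ^ 2) * u) * (L - u) + b * u * (U - u) / (L - U) := by
    field_simp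
    ring
  have hlt : (a - (a / U - v ^ 2) * u) * (L - u) <
      (v ^ 2 - a / U + b / (L - U)) * u * (L - u) - (a + b) * u + a * L := by
    rw [hE]
    exact lt_add_of_pos_right _ (by positivity)
  calc _ < Real.sqrt (u * (L - u)) / Real.sqrt ((a - (a / U - v ^ 2) * u) * (L - u)) := by
        have : 0 < (a - (a / U - v ^ 2) * u) * (L - u) := mul_pos hD hLu
        gcongr
    _ = _ := by
        rw [Real.sqrt_mul hu0.le, Real.sqrt_mul hD.le,
          mul_div_mul_right _ _ (ne_of_gt (Real.sqrt_pos.2 hLu))]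

/-- The collapse-time integral with the repeller is strictly smaller than the
collapse-time integral without it:
`∫₀^U √(u(L-u))/√(C u(L-u) - (a+b)u + aL) du < ∫₀^U √u/√(a - βu) du`
with `C = v₀² - a/U + b/(L-U)` and `β = a/U - v₀² > 0`. -/
theorem dipole_integral_lt_attractor_integral
    (a b L U v₀ : ℝ) (ha : 0 < a) (hb : 0 < b) (hL : 0 < L)
    (hU : U ∈ Set.Ioo (0 : ℝ) L) (hneg : v₀ ^ 2 - a / U < 0) :
    (∫ u in (0 : ℝ)..U,
        Real.sqrt (u * (L - u)) /
          Real.sqrt ((v₀ ^ 2 - a / U + b / (L - U)) * u * (L - u) -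
            (a + b) * u + a * L)) <
      ∫ u in (0 : ℝ)..U,
        Real.sqrt u / Real.sqrt (a - (a / U - v₀ ^ 2) * u) := by
  have hg := intervalIntegrable_sqrt_div_sqrt_sub v₀ ha hU.1
  have hlt := fun u hu => sqrt_div_sqrt_dipole_lt (u := u) v₀ ha hb hU.2 hu
  have hf : IntervalIntegrable (fun u => Real.sqrt (u * (L - u)) /
      Real.sqrt ((v₀ ^ 2 - a / U + b / (L - U)) * u * (L - u) - (a + b) * u + a * L))
      MeasureTheory.volume 0 U := by
    refine hg.mono_fun' (Measurable.aestronglyMeasurable (by fun_prop)) ?_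
    rw [Set.uIoc_of_le hU.1.le, Filter.EventuallyLE,
    MeasureTheory.ae_restrict_iff' measurableSet_Ioc]
    filter_upwards [MeasureTheory.Measure.ae_ne MeasureTheory.volume U] with u hne hu
    rw [Real.norm_of_nonneg (by positivity)]
    exact (hlt u ⟨hu.1, lt_of_le_of_ne hu.2 hne⟩).le
  rw [← sub_pos, ← intervalIntegral.integral_sub hg hf]
  exact intervalIntegral.intervalIntegral_pos_of_pos_on (hg.sub hf)
    (fun u hu => sub_pos.2 (hlt u hu)) hU.1
end

section
/- Let b > 0, L > 0, U ∈ (0, L), v₀ ≠ 0, and set C = v₀² + b/(L-U), so that C(L-u) - b > 0 for u ∈ [0, U]. Then the repeller-alone collapse time satisfies ∫₀^U √(L-u) / √(C(L-u) - b) du = (b/(C √C)) · [ x √(x² - 1) + log(x + √(x² - 1)) ] evaluated between x₁ = √(C/b) √(L-U) and x₂ = √(C/b) √L, i.e. the integral equals (b/(C√C)) ( x₂√(x₂²-1) + log(x₂+√(x₂²-1)) - x₁√(x₁²-1) - log(x₁+√(x₁²-1)) ). -/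
theorem Real.hasDerivAt_mul_sqrt_sq_sub_one_add_log {x : ℝ} (hx : 1 < x) :
    HasDerivAt (fun y : ℝ => y * √(y ^ 2 - 1) + Real.log (y + √(y ^ 2 - 1)))
      (2 * x ^ 2 / √(x ^ 2 - 1)) x := by
  have hpos : 0 < x ^ 2 - 1 := by nlinarith
  have hs : 0 < √(x ^ 2 - 1) := Real.sqrt_pos.2 hpos
  have hsq : √(x ^ 2 - 1) ^ 2 = x ^ 2 - 1 := Real.sq_sqrt hpos.le
  have hroot : HasDerivAt (fun y : ℝ => √(y ^ 2 - 1)) (x / √(x ^ 2 - 1)) x := by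
    refine (((hasDerivAt_pow 2 x).sub_const 1).sqrt hpos.ne').congr_deriv ?_
    field_simp
    simp
  have hsum : x + √(x ^ 2 - 1) ≠ 0 := by positivity
  refine (((hasDerivAt_id x).mul hroot).add
    (((hasDerivAt_id x).add hroot).log hsum)).congr_deriv ?_
  simp only [id_eq]
  have hlog : (1 + x / √(x ^ 2 - 1)) / (x + √(x ^ 2 - 1)) = 1 / √(x ^ 2 - 1) := by
    field_simp
    ring
  change 1 * √(x ^ 2 - 1) + x * (x / √(x ^ 2 - 1)) +
    (1 + x / √(x ^ 2 - 1)) / (x + √(x ^ 2 - 1)) = _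
  rw [hlog]
  field_simp
  rw [hsq]
  ring

theorem hasDerivAt_repeller_primitive {b C L u : ℝ} (hb : 0 < b) (hC : 0 < C)
    (hu : u < L) (hpos : 0 < C * (L - u) - b) :
    HasDerivAt
      (fun t : ℝ => -(b / (C * √C)) *
        ((√(C / b) * √(L - t)) * √((√(C / b) * √(L - t)) ^ 2 - 1) +
          Real.log (√(C / b) * √(L - t) + √((√(C / b) * √(L - t)) ^ 2 - 1))))
      (√(L - u) / √(C * (L - u) - b)) u := by
  have hw : 0 < L - u := sub_pos.2 hu
  have hsq : (√(C / b) * √(L - u)) ^ 2 = C / b * (L - u) := by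
    rw [mul_pow, Real.sq_sqrt (by positivity), Real.sq_sqrt hw.le]
  have hsub : (√(C / b) * √(L - u)) ^ 2 - 1 = (C * (L - u) - b) / b := by
    rw [hsq]
    field_simp
  have hx : 1 < √(C / b) * √(L - u) := by
    have : 0 < (√(C / b) * √(L - u)) ^ 2 - 1 := hsub ▸ div_pos hpos hb
    exact (one_lt_sq_iff₀ (by positivity)).1 (by linarith)
  have hinner : HasDerivAt (fun t : ℝ => √(C / b) * √(L - t))
      (√(C / b) * (-1 / (2 * √(L - u)))) u :=
    (((hasDerivAt_id u).const_sub L).sqrt hw.ne').const_mul _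
  refine (((Real.hasDerivAt_mul_sqrt_sq_sub_one_add_log hx).comp u hinner).const_mul
    (-(b / (C * √C)))).congr_deriv ?_
  rw [hsub, hsq, Real.sqrt_div hpos.le, Real.sqrt_div hC.le]
  have h1 : 0 < √C := Real.sqrt_pos.2 hC
  have h2 : 0 < √b := Real.sqrt_pos.2 hb
  have h3 : 0 < √(L - u) := Real.sqrt_pos.2 hw
  have h4 : 0 < √(C * (L - u) - b) := Real.sqrt_pos.2 hpos
  field_simp
  rw [Real.sq_sqrt hw.le]


/-- Exact collapse time under the repeller alone: with `C = v₀² + b/(L-U)`,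
`∫₀^U √(L-u)/√(C(L-u) - b) du = (b/(C√C)) [x √(x²-1) + log(x + √(x²-1))]`
evaluated between `x₁ = √(C/b) √(L-U)` and `x₂ = √(C/b) √L`. -/
theorem repeller_alone_collapse_time
    (b L U v₀ : ℝ) (hb : 0 < b) (hL : 0 < L)
    (hU : U ∈ Set.Ioo (0 : ℝ) L) (hv₀ : v₀ ≠ 0) :
    ∫ u in (0 : ℝ)..U,
        Real.sqrt (L - u) /
          Real.sqrt ((v₀ ^ 2 + b / (L - U)) * (L - u) - b) =
      (b / ((v₀ ^ 2 + b / (L - U)) * Real.sqrt (v₀ ^ 2 + b / (L - U)))) *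
        ((Real.sqrt ((v₀ ^ 2 + b / (L - U)) / b) * Real.sqrt L) *
            Real.sqrt ((Real.sqrt ((v₀ ^ 2 + b / (L - U)) / b) * Real.sqrt L) ^ 2 - 1) +
          Real.log ((Real.sqrt ((v₀ ^ 2 + b / (L - U)) / b) * Real.sqrt L) +
            Real.sqrt ((Real.sqrt ((v₀ ^ 2 + b / (L - U)) / b) * Real.sqrt L) ^ 2 - 1)) -
          (Real.sqrt ((v₀ ^ 2 + b / (L - U)) / b) * Real.sqrt (L - U)) *
            Real.sqrt ((Real.sqrt ((v₀ ^ 2 + b / (L - U)) / b) * Real.sqrt (L - U)) ^ 2 - 1) -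
          Real.log ((Real.sqrt ((v₀ ^ 2 + b / (L - U)) / b) * Real.sqrt (L - U)) +
            Real.sqrt ((Real.sqrt ((v₀ ^ 2 + b / (L - U)) / b) * Real.sqrt (L - U)) ^ 2 - 1))) := by
  obtain ⟨hU0, hUL⟩ := hU
  have hw : 0 < L - U := sub_pos.2 hUL
  have hCU : (v₀ ^ 2 + b / (L - U)) * (L - U) = v₀ ^ 2 * (L - U) + b := by
    field_simp
  have hv : 0 < v₀ ^ 2 * (L - U) := by positivity
  have hC : 0 < v₀ ^ 2 + b / (L - U) := by positivity
  generalize v₀ ^ 2 + b / (L - U) = C at *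
  have hlt : ∀ u ∈ Set.uIcc 0 U, u < L ∧ 0 < C * (L - u) - b := by
    intro u hu
    rw [Set.uIcc_of_le hU0.le] at hu
    exact ⟨hu.2.trans_lt hUL, by nlinarith [mul_nonneg hC.le (sub_nonneg.2 hu.2)]⟩
  have hint : IntervalIntegrable (fun u => √(L - u) / √(C * (L - u) - b))
      MeasureTheory.volume 0 U := by
    refine ContinuousOn.intervalIntegrable (ContinuousOn.div (by fun_prop) (by fun_prop) ?_)
    exact fun u hu => (Real.sqrt_pos.2 (hlt u hu).2).ne'
  rw [intervalIntegral.integral_eq_sub_of_hasDerivAt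
    (fun u hu => hasDerivAt_repeller_primitive hb hC (hlt u hu).1 (hlt u hu).2) hint, sub_zero]
  ring
end
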